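/- Fix a label class i, parameters η ≥ 0, q ≥ 0, c > 0, and a class F of classifiers. Suppose the collection M'_η = { R_η(f) ∩ {x ∈ S_i^good ∩ D_overlap : f(x) = y(x)} : f ∈ F } satisfies (c,q,η)-robust expansion on (S_i^bad ∩ D_hard, S_i^good ∩ D_overlap), and let f ∈ F satisfy P(f(x) ≠ f_weak(x) or r(f,x) > η | S_i ∩ D_overlap) ≤ 1 − q − ε₁. Then P(U_i | S_i^bad ∩ D_hard) ≥ c · P(V_i | S_i^good ∩ D_overlap), where U_i = S_i ∖ {x ∈ S_i : f(x) ≠ y(x)} and V_i = R_η(f) ∩ U_i ∩ S_i^good ∩ D_overlap. -/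

import Mathlib

/-!
Framework: finite probability space, neighborhoods, robust expansion
(following Lang et al. 2024), pseudolabelers and easy/hard/overlap partition.
-/

open Set

/-- Probability of a set `A` under a mass function `p` on a finite type. -/
noncomputable def pr {X : Type*} [Fintype X] (p : X → ℝ) (A : Set X) : ℝ :=
  ∑ x, A.indicator p x

/-- Conditional probability `P(A | B)`. -/
noncomputable def cpr {X : Type*} [Fintype X] (p : X → ℝ) (A B : Set X) : ℝ :=
  pr p (A ∩ B) / pr p B

/-- Neighborhood of a set: `N(A) = ⋃_{x ∈ A} N(x)`. -/
def nbhdSet {X : Type*} (N : X → Set X) (A : Set X) : Set X :=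
  ⋃ x ∈ A, N x

/-- Total edge weight between sets: `w(V,U) = ∑_{x ∈ V, x' ∈ U} P(x)P(x')𝟙[x ∈ N(x')]`. -/
noncomputable def wSet {X : Type*} [Fintype X] (p : X → ℝ) (N : X → Set X)
    (V U : Set X) : ℝ :=
  ∑ x, ∑ x', V.indicator p x * U.indicator p x' * (N x').indicator (fun _ => (1 : ℝ)) x

/-- Robustness `r(f,x) = P(f(x') ≠ f(x) | x' ∈ N(x))`. -/
noncomputable def rob {X Y : Type*} [Fintype X] (p : X → ℝ) (N : X → Set X)
    (f : X → Y) (x : X) : ℝ :=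
  cpr p {x' | f x' ≠ f x} (N x)

/-- The set of `η`-robust points `R_η(f)`. -/
def Reta {X Y : Type*} [Fintype X] (p : X → ℝ) (N : X → Set X) (η : ℝ)
    (f : X → Y) : Set X :=
  {x | rob p N f x ≤ η}

/-- `η`-robust neighborhood size
`P_{1-η}(U,A) = min { P(V|A) : w(V,U) ≥ (1-η) w(N(U),U) }`. -/
noncomputable def robNbhd {X : Type*} [Fintype X] (p : X → ℝ) (N : X → Set X)
    (η : ℝ) (U A : Set X) : ℝ :=
  sInf {r : ℝ | ∃ V : Set X,
    (1 - η) * wSet p N (nbhdSet N U) U ≤ wSet p N V U ∧ r = cpr p V A}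

/-- A collection `M` of subsets of `B` satisfies `(c,q,η)`-robust expansion on `(A,B)`. -/
def RobustExpansion {X : Type*} [Fintype X] (p : X → ℝ) (N : X → Set X)
    (c q η : ℝ) (M : Set (Set X)) (A B : Set X) : Prop :=
  ∀ U ∈ M, q < cpr p U B → c * cpr p U B < robNbhd p N η U A


lemma pr_nonneg {X : Type*} [Fintype X] {p : X → ℝ} (hp : ∀ x, 0 ≤ p x) (A : Set X) :
    0 ≤ pr p A :=
  Finset.sum_nonneg fun x _ => Set.indicator_nonneg (fun x _ => hp x) x

lemma pr_mono {X : Type*} [Fintype X] {p : X → ℝ} (hp : ∀ x, 0 ≤ p x) {A B : Set X}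
    (h : A ⊆ B) : pr p A ≤ pr p B :=
  Finset.sum_le_sum fun x _ => Set.indicator_le_indicator_of_subset h hp x

lemma pr_inter_add_diff {X : Type*} [Fintype X] (p : X → ℝ) (A B : Set X) :
    pr p (A ∩ B) + pr p (A \ B) = pr p A := by
  classical
  simp only [pr, ← Finset.sum_add_distrib]
  refine Finset.sum_congr rfl fun x _ => ?_
  by_cases hA : x ∈ A <;> by_cases hB : x ∈ B <;> simp [Set.indicator, hA, hB]

lemma cpr_nonneg {X : Type*} [Fintype X] {p : X → ℝ} (hp : ∀ x, 0 ≤ p x) (A B : Set X) :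
    0 ≤ cpr p A B :=
  div_nonneg (pr_nonneg hp _) (pr_nonneg hp _)

lemma pr_inter_le_of_cpr_le {X : Type*} [Fintype X] {p : X → ℝ} (hp : ∀ x, 0 ≤ p x)
    {A B : Set X} {t : ℝ} (h : cpr p A B ≤ t) : pr p (A ∩ B) ≤ t * pr p B := by
  rcases (pr_nonneg hp B).eq_or_lt with h0 | h0
  · rw [← h0, mul_zero, h0]
    exact pr_mono hp Set.inter_subset_right
  · exact (div_le_iff₀ h0).1 h

lemma wSet_eq_sum {X : Type*} [Fintype X] (p : X → ℝ) (N : X → Set X) (V U : Set X) :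
    wSet p N V U = ∑ x', U.indicator p x' * pr p (V ∩ N x') := by
  classical
  rw [wSet, Finset.sum_comm]
  refine Finset.sum_congr rfl fun x' _ => ?_
  rw [pr, Finset.mul_sum]
  refine Finset.sum_congr rfl fun x _ => ?_
  by_cases hV : x ∈ V <;> by_cases hN : x ∈ N x' <;> simp [Set.indicator, hV, hN, mul_comm]

/-- If every point of `U` is `η`-robust with label `i`, then the level set `{f = i}` carries at
least a `1 - η` fraction of the edge weight between `U` and its neighborhood. -/
lemma one_sub_mul_wSet_nbhdSet_le {X Y : Type*} [Fintype X] {p : X → ℝ} (hp : ∀ x, 0 ≤ p x)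
    (N : X → Set X) {η : ℝ} {f : X → Y} {i : Y} {U : Set X} (hU : U ⊆ Reta p N η f)
    (hi : ∀ x ∈ U, f x = i) :
    (1 - η) * wSet p N (nbhdSet N U) U ≤ wSet p N {x | f x = i} U := by
  classical
  rw [wSet_eq_sum, wSet_eq_sum, Finset.mul_sum]
  refine Finset.sum_le_sum fun x' _ => ?_
  by_cases hx : x' ∈ U
  · have hN : nbhdSet N U ∩ N x' = N x' :=
      Set.inter_eq_right.2 (Set.subset_biUnion_of_mem (u := N) hx)
    have hr := pr_inter_le_of_cpr_le hp (show cpr p {z | f z ≠ f x'} (N x') ≤ η from hU hx)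
    have hs := pr_inter_add_diff p (N x') {z | f z = i}
    have hd : N x' \ {z | f z = i} = {z | f z ≠ f x'} ∩ N x' := by
      ext z; simp [hi x' hx, and_comm]
    rw [hd, Set.inter_comm (N x')] at hs
    rw [hN, Set.indicator_of_mem hx]
    nlinarith [mul_le_mul_of_nonneg_left
      (show (1 - η) * pr p (N x') ≤ pr p ({z | f z = i} ∩ N x') by linarith) (hp x')]
  · simp [Set.indicator_of_notMem hx]

lemma robNbhd_le {X : Type*} [Fintype X] {p : X → ℝ} (hp : ∀ x, 0 ≤ p x) {N : X → Set X}
    {η : ℝ} {U V : Set X} (A : Set X)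
    (h : (1 - η) * wSet p N (nbhdSet N U) U ≤ wSet p N V U) :
    robNbhd p N η U A ≤ cpr p V A := by
  refine csInf_le ⟨0, ?_⟩ ⟨V, h, rfl⟩
  rintro r ⟨W, -, rfl⟩
  exact cpr_nonneg hp W A

theorem expand_set_bound
    {X Y : Type*} [Fintype X]
    (p : X → ℝ) (hp0 : ∀ x, 0 ≤ p x) (hp1 : ∑ x, p x = 1)
    (N : X → Set X) (hNsymm : ∀ x x', x ∈ N x' ↔ x' ∈ N x)
    (y : X → Y) (fw : X → Option Y)
    (Deasy Dhard Dover : Set X)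
    (hcover : Deasy ∪ Dhard ∪ Dover = Set.univ)
    (hdis1 : Disjoint Deasy Dhard) (hdis2 : Disjoint Deasy Dover)
    (hdis3 : Disjoint Dhard Dover)
    (i : Y)
    (S Si Sgood Sbad : Set X)
    (hS : S = {x | fw x ≠ none})
    (hSi : Si = {x ∈ S | y x = i})
    (hSgood : Sgood = {x ∈ Si | fw x = some (y x)})
    (hSbad : Sbad = Si \ Sgood)
    (ε₁ ε₂ : ℝ)
    (hε₁ : ε₁ = cpr p {x | fw x ≠ some (y x)} (Si ∩ Dover))
    (hε₁' : ε₁ = cpr p {x | fw x ≠ some (y x)} (Si ∩ Deasy))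
    (hε₂ : ε₂ = cpr p {x | fw x ≠ some (y x)} (Si ∩ Dhard))
    (hε₁pos : 0 < ε₁) (hε₁₂ : ε₁ ≤ ε₂) (hε₂half : ε₂ ≤ 1 / 2)
    (η q c : ℝ) (hη : 0 ≤ η) (hq : 0 ≤ q) (hc : 0 < c)
    (F : Set (X → Y))
    (hexp : RobustExpansion p N c q η
      ((fun f => Reta p N η f ∩ {x ∈ Sgood ∩ Dover | f x = y x}) '' F)
      (Sbad ∩ Dhard) (Sgood ∩ Dover))
    (f : X → Y) (hfF : f ∈ F)
    (hf : cpr p {x | some (f x) ≠ fw x ∨ η < rob p N f x} (Si ∩ Dover)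
      ≤ 1 - q - ε₁)
    (Ui Vi : Set X)
    (hUi : Ui = Si \ {x ∈ Si | f x ≠ y x})
    (hVi : Vi = Reta p N η f ∩ Ui ∩ Sgood ∩ Dover) :
    c * cpr p Vi (Sgood ∩ Dover) ≤ cpr p Ui (Sbad ∩ Dhard) := by
  have hVi' : Vi = Reta p N η f ∩ {x ∈ Sgood ∩ Dover | f x = y x} := by
    subst hVi hUi hSgood
    ext x
    simp only [Set.mem_inter_iff, Set.mem_sdiff, Set.mem_ofPred_eq]
    tauto
  rcases (cpr_nonneg hp0 Vi (Sgood ∩ Dover)).eq_or_lt with h0 | hVpos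
  · rw [← h0, mul_zero]
    exact cpr_nonneg hp0 _ _
  have hSiy : ∀ x ∈ Si, y x = i := by
    intro x hx
    rw [hSi] at hx
    exact hx.2
  have hSgoodSi : Sgood ⊆ Si := by
    rw [hSgood]
    exact fun x hx => hx.1
  have hBpos : 0 < pr p (Si ∩ Dover) := by
    refine (pr_nonneg hp0 _).lt_of_ne fun h => hε₁pos.ne' ?_
    rw [hε₁, cpr, ← h, div_zero]
  have hqlt : q < cpr p Vi (Sgood ∩ Dover) := by
    rcases hq.eq_or_lt with rfl | hqpos
    · exact hVpos
    have hbad : pr p ({x | fw x ≠ some (y x)} ∩ (Si ∩ Dover)) = ε₁ * pr p (Si ∩ Dover) := by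
      rw [hε₁, cpr, div_mul_cancel₀ _ hBpos.ne']
    have hgood : pr p (Sgood ∩ Dover) = (1 - ε₁) * pr p (Si ∩ Dover) := by
      have h := pr_inter_add_diff p (Si ∩ Dover) {x | fw x ≠ some (y x)}
      have hd : (Si ∩ Dover) \ {x | fw x ≠ some (y x)} = Sgood ∩ Dover := by
        rw [hSgood]
        ext x
        simp only [Set.mem_inter_iff, Set.mem_sdiff, Set.mem_ofPred_eq]
        tauto
      rw [hd, Set.inter_comm, hbad] at h
      linarith
    have hV : q * pr p (Si ∩ Dover) ≤ pr p Vi := by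
      have hf' := pr_inter_le_of_cpr_le hp0 hf
      have h := pr_inter_add_diff p (Si ∩ Dover) {x | some (f x) ≠ fw x ∨ η < rob p N f x}
      have h₂ := pr_inter_add_diff p
        ((Si ∩ Dover) \ {x | some (f x) ≠ fw x ∨ η < rob p N f x}) {x | fw x ≠ some (y x)}
      have hle₁ := pr_mono hp0 (p := p)
        (A := ((Si ∩ Dover) \ {x | some (f x) ≠ fw x ∨ η < rob p N f x}) ∩
          {x | fw x ≠ some (y x)})
        (B := {x | fw x ≠ some (y x)} ∩ (Si ∩ Dover)) fun x hx => ⟨hx.2, hx.1.1⟩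
      have hle₂ := pr_mono hp0 (p := p)
        (A := ((Si ∩ Dover) \ {x | some (f x) ≠ fw x ∨ η < rob p N f x}) \
          {x | fw x ≠ some (y x)}) (B := Vi) (by
        rintro x ⟨⟨⟨hx, hxD⟩, hxf⟩, hxw⟩
        simp only [Set.mem_ofPred_eq, not_or, not_not, not_lt] at hxf hxw
        rw [hVi', hSgood]
        exact ⟨hxf.2, ⟨⟨hx, hxw⟩, hxD⟩, Option.some.inj (hxf.1.trans hxw)⟩)
      rw [Set.inter_comm] at h
      linarith
    have hVsub : Vi ∩ (Sgood ∩ Dover) = Vi := by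
      rw [Set.inter_eq_left, hVi']
      exact fun x hx => hx.2.1
    rw [cpr, hVsub, hgood, lt_div_iff₀ (mul_pos (by linarith) hBpos)]
    nlinarith [mul_pos (mul_pos hqpos hε₁pos) hBpos]
  have hlt := hexp Vi ⟨f, hfF, hVi'.symm⟩ hqlt
  have hle : robNbhd p N η Vi (Sbad ∩ Dhard) ≤ cpr p {x | f x = i} (Sbad ∩ Dhard) := by
    refine robNbhd_le hp0 _ (one_sub_mul_wSet_nbhdSet_le hp0 N ?_ ?_) <;> rw [hVi']
    · exact Set.inter_subset_left
    · exact fun x hx => hx.2.2.trans (hSiy x (hSgoodSi hx.2.1.1))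
  have heq : {x | f x = i} ∩ (Sbad ∩ Dhard) = Ui ∩ (Sbad ∩ Dhard) := by
    rw [hUi, hSbad]
    ext x
    simp only [Set.mem_inter_iff, Set.mem_sdiff, Set.mem_ofPred_eq]
    have := hSiy x
    constructor
    · rintro ⟨h, h'⟩
      refine ⟨⟨h'.1.1, fun hx => hx.2 (h.trans (this h'.1.1).symm)⟩, h'⟩
    · rintro ⟨h, h'⟩
      refine ⟨?_, h'⟩
      by_contra hne
      exact h.2 ⟨h.1, fun he => hne (he.trans (this h.1))⟩
  rw [cpr, heq] at hle
  exact (hlt.trans_le hle).le
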